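/- Let φ : ℕ → (0,∞) be a function with φ(n) → ∞ as n → ∞, and set γ = limsup_{n→∞} (∑_{k=1}^{n+1} φ(k)) / (∑_{k=1}^{n} (n−k+1)·φ(k)). Then dim_H { Π(c) : c = (c_n)_{n≥1} a strictly increasing sequence of integers with c₁ ≥ 2 and lim_{n→∞} (log(c_n/c_{n−1}))/φ(n) = 1 } = 1/(1+γ), and also dim_H { Π(c) : c = (c_n)_{n≥1} a strictly increasing sequence of integers with c₁ ≥ 2 and lim_{n→∞} (log((c_n−1)/(c_{n−1}−1)))/φ(n) = 1 } = 1/(1+γ). -/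

import Mathlib

open Filter

noncomputable section

/-- The classical Engel series `E(c) = ∑_{n≥1} 1/(c₁c₂⋯c_n)` (0-based: `c 0 = c₁`). -/
def engel (c : ℕ → ℕ) : ℝ :=
  ∑' n : ℕ, 1 / ∏ i ∈ Finset.range (n + 1), (c i : ℝ)

/-- The modified Engel series
`E'(c) = 1/c₁ + ∑_{n≥1} 1/((c₁−1)(c₂−1)⋯(c_n−1)·c_{n+1})` (0-based: `c 0 = c₁`). -/
def modEngel (c : ℕ → ℕ) : ℝ :=
  1 / (c 0 : ℝ) +
    ∑' n : ℕ, 1 / ((∏ i ∈ Finset.range (n + 1), ((c i : ℝ) - 1)) * (c (n + 1) : ℝ))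

/-- The digit shift `σ(c)_n = c_n + n − 1` (0-based: `σ(c) (n-1) = c (n-1) + (n-1)`). -/
def engelShift (c : ℕ → ℕ) : ℕ → ℕ := fun n => c n + n

/-- The Pierce series in Perron notation
`Π(c) = ∑_{n≥0} (−1)^n/((c₁−1)⋯(c_n−1)(c_{n+1}−1))` (0-based: `c 0 = c₁`). -/
def pierce (c : ℕ → ℕ) : ℝ :=
  ∑' n : ℕ, (-1 : ℝ) ^ n / ((∏ i ∈ Finset.range n, ((c i : ℝ) - 1)) * ((c n : ℝ) - 1))

/-- The traditional Pierce series `Π̃(d) = ∑_{n≥1} (−1)^{n+1}/(d₁d₂⋯d_n)` (0-based: `d 0 = d₁`). -/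
def pierceTrad (d : ℕ → ℕ) : ℝ :=
  ∑' n : ℕ, (-1 : ℝ) ^ n / ∏ i ∈ Finset.range (n + 1), (d i : ℝ)

end

open scoped ENNReal

/-- `γ = limsup_n (∑_{k=1}^{n+1} φ(k)) / (∑_{k=1}^{n} (n−k+1)·φ(k))` (as an extended real;
0-based: `φ 0 = φ(1)`). -/
noncomputable def gammaExp (φ : ℕ → ℝ) : ℝ≥0∞ :=
  Filter.limsup (fun n : ℕ => ENNReal.ofReal
    ((∑ k ∈ Finset.range (n + 1), φ k) /
      (∑ k ∈ Finset.range n, ((n - k : ℕ) : ℝ) * φ k))) atTop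


noncomputable def Qs (d : ℕ → ℝ) : ℝ :=
  ∑' n : ℕ, (-1 : ℝ) ^ n * (1 / ∏ i ∈ Finset.range (n + 1), d i)

def GoodD (d : ℕ → ℝ) : Prop := ∀ i : ℕ, (i : ℝ) + 1 ≤ d i

lemma GoodD.pos {d : ℕ → ℝ} (h : GoodD d) (i : ℕ) : 0 < d i := by
  have := h i
  have : (0:ℝ) ≤ i := Nat.cast_nonneg i
  linarith

lemma GoodD.shift {d : ℕ → ℝ} (h : GoodD d) (n : ℕ) : GoodD (fun i => d (i + n)) := by
  intro i
  have := h (i + n)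
  push_cast at this
  have : (0:ℝ) ≤ n := Nat.cast_nonneg n
  simp only
  linarith

lemma GoodD.prod_pos {d : ℕ → ℝ} (h : GoodD d) (n : ℕ) : 0 < ∏ i ∈ Finset.range n, d i :=
  Finset.prod_pos fun i _ => h.pos i

lemma GoodD.fact_le {d : ℕ → ℝ} (h : GoodD d) (n : ℕ) :
    (n.factorial : ℝ) ≤ ∏ i ∈ Finset.range n, d i := by
  induction n with
  | zero => simp
  | succ n ih =>
    rw [Finset.prod_range_succ, Nat.factorial_succ, mul_comm]
    push_cast
    exact mul_le_mul ih (h n) (by positivity) (h.prod_pos n).le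

lemma GoodD.summable {d : ℕ → ℝ} (h : GoodD d) :
    Summable (fun n : ℕ => (-1 : ℝ) ^ n * (1 / ∏ i ∈ Finset.range (n + 1), d i)) := by
  have h1 : Summable (fun n : ℕ => (1:ℝ) ^ (n+1) / ((n+1).factorial : ℝ)) :=
    (summable_nat_add_iff 1).2 (Real.summable_pow_div_factorial 1)
  refine Summable.of_norm_bounded h1 fun n => ?_
  rw [norm_mul, norm_pow, norm_neg, norm_one, one_pow, one_mul, one_pow,
    Real.norm_of_nonneg (by have := h.prod_pos (n+1); positivity)]
  exact one_div_le_one_div_of_le (by positivity) (h.fact_le _)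

lemma GoodD.anti {d : ℕ → ℝ} (h : GoodD d) :
    Antitone (fun n : ℕ => 1 / ∏ i ∈ Finset.range (n + 1), d i) := by
  refine antitone_nat_of_succ_le fun n => ?_
  refine one_div_le_one_div_of_le (h.prod_pos _) ?_
  rw [Finset.prod_range_succ _ (n+1)]
  have := h (n+1)
  have h2 : (0:ℝ) ≤ ((n+1:ℕ):ℝ) := Nat.cast_nonneg _
  exact le_mul_of_one_le_right (h.prod_pos _).le (by linarith)

lemma GoodD.Q_nonneg {d : ℕ → ℝ} (h : GoodD d) : 0 ≤ Qs d := by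
  have := h.anti.alternating_series_le_tendsto h.summable.hasSum.tendsto_sum_nat 0
  simpa [Qs] using this

lemma GoodD.Q_le {d : ℕ → ℝ} (h : GoodD d) : Qs d ≤ 1 / d 0 := by
  have := h.anti.tendsto_le_alternating_series h.summable.hasSum.tendsto_sum_nat 0
  simpa [Qs] using this

lemma GoodD.Q_rec {d : ℕ → ℝ} (h : GoodD d) :
    Qs d = 1 / d 0 - 1 / d 0 * Qs (fun i => d (i + 1)) := by
  unfold Qs
  rw [h.summable.tsum_eq_zero_add, ← tsum_mul_left, sub_eq_add_neg, ← tsum_neg]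
  congr 1
  · simp
  · refine tsum_congr fun n => ?_
    rw [Finset.prod_range_succ' _ (n+1), pow_succ]
    have := (h.shift 1).prod_pos (n+1)
    have := h.pos 0
    field_simp

lemma Q_diff {n : ℕ} : ∀ {d d' : ℕ → ℝ}, GoodD d → GoodD d' → (∀ i < n, d i = d' i) →
    |Qs d - Qs d'| = (1 / ∏ i ∈ Finset.range n, d i) *
      |Qs (fun i => d (i + n)) - Qs (fun i => d' (i + n))| := by
  induction n with
  | zero => intro d d' _ _ _; simp
  | succ n ih =>
    intro d d' h h' he
    have h0 := h.pos 0
    have := (h.shift 1).prod_pos n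
    have e := ih (h.shift 1) (h'.shift 1) (fun i hi => he (i+1) (by omega))
    rw [h.Q_rec, h'.Q_rec, ← he 0 (by omega), Finset.prod_range_succ']
    have : 1 / d 0 - 1 / d 0 * Qs (fun i => d (i + 1)) - (1 / d 0 - 1 / d 0 * Qs (fun i => d' (i + 1)))
      = - (1 / d 0 * (Qs (fun i => d (i + 1)) - Qs (fun i => d' (i + 1)))) := by ring
    rw [this, abs_neg, abs_mul, e, abs_of_pos (by positivity)]
    simp only [add_assoc]
    field_simp

lemma Q_diff_le {n : ℕ} {d d' : ℕ → ℝ} (h : GoodD d) (h' : GoodD d') (he : ∀ i < n, d i = d' i)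
    {r : ℝ} (hr : 0 < r) (h1 : r ≤ d n) (h2 : r ≤ d' n) :
    |Qs d - Qs d'| ≤ (1 / ∏ i ∈ Finset.range n, d i) * (1 / r) := by
  rw [Q_diff h h' he]
  have := h.prod_pos n
  refine mul_le_mul_of_nonneg_left ?_ (by positivity)
  have a1 := (h.shift n).Q_nonneg
  have a2 := (h.shift n).Q_le
  have b1 := (h'.shift n).Q_nonneg
  have b2 := (h'.shift n).Q_le
  simp only [zero_add] at a2 b2
  have := one_div_le_one_div_of_le hr h1
  have := one_div_le_one_div_of_le hr h2
  rw [abs_le]; constructor <;> linarith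

lemma Q_gap {d d' : ℕ → ℝ} (h : GoodD d) (h' : GoodD d') {m B : ℝ} (hm : 1 ≤ m)
    (hdd : d 0 + m ≤ d' 0) (hB : d' 0 ≤ 2 * B) (hB1 : 4 * B ≤ d 1) :
    m / (8 * B ^ 2) ≤ Qs d - Qs d' := by
  have h0 := h.pos 0
  have h0' := h'.pos 0
  have h1 := h.pos 1
  have hBp : 0 < B := by linarith
  have a : 1 / d 0 - 1 / d 0 * (1 / d 1) ≤ Qs d := by
    rw [h.Q_rec]
    have := (h.shift 1).Q_le
    simp only [zero_add] at this
    have := mul_le_mul_of_nonneg_left this (by positivity : 0 ≤ 1 / d 0)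
    linarith
  have b := h'.Q_le
  have k : d' 0 / d 1 ≤ 1 / 2 := by
    rw [div_le_div_iff₀ h1 (by norm_num)]; linarith
  have e : 1 / d 0 - 1 / d 0 * (1 / d 1) - 1 / d' 0 = (d' 0 - d 0 - d' 0 / d 1) / (d 0 * d' 0) := by
    field_simp
    ring
  have : m / (8 * B ^ 2) ≤ (d' 0 - d 0 - d' 0 / d 1) / (d 0 * d' 0) := by
    have q1 : m / (8 * B^2) = (m / 2) / (2 * B * (2 * B)) := by field_simp; norm_num
    rw [q1]
    apply div_le_div₀ (by linarith) (by linarith) (by positivity)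
    apply mul_le_mul <;> linarith
  linarith

lemma pierce_eq_Qs (c : ℕ → ℕ) : pierce c = Qs (fun i => (c i : ℝ) - 1) := by
  unfold pierce Qs
  refine tsum_congr fun n => ?_
  rw [← Finset.prod_range_succ (fun i => (c i : ℝ) - 1), mul_one_div]

lemma goodD_of {c : ℕ → ℕ} (hc : StrictMono c) (h0 : 2 ≤ c 0) : GoodD (fun i => (c i : ℝ) - 1) := by
  have : ∀ i, i + 2 ≤ c i := by
    intro i
    induction i with
    | zero => simpa using h0
    | succ n ih => have := hc (Nat.lt_succ_self n); simp only [Nat.succ_eq_add_one] at this; omega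
  intro i
  have : ((i + 2 : ℕ) : ℝ) ≤ c i := by exact_mod_cast this i
  push_cast at this
  simp only
  linarith

noncomputable def Sf (φ : ℕ → ℝ) (n : ℕ) : ℝ := ∑ k ∈ Finset.range n, φ k
noncomputable def Tf (φ : ℕ → ℝ) (n : ℕ) : ℝ := ∑ k ∈ Finset.range n, ((n - k : ℕ) : ℝ) * φ k

lemma Tf_succ (φ : ℕ → ℝ) (n : ℕ) : Tf φ (n + 1) = Tf φ n + Sf φ (n + 1) := by
  unfold Tf Sf
  rw [Finset.sum_range_succ, Finset.sum_range_succ _ n, ← add_assoc, ← Finset.sum_add_distrib]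
  congr 1
  · refine Finset.sum_congr rfl fun k hk => ?_
    have : k < n := Finset.mem_range.1 hk
    rw [show n + 1 - k = (n - k) + 1 by omega]
    push_cast
    ring
  · simp

lemma Tf_eq (φ : ℕ → ℝ) (n : ℕ) : Tf φ n = ∑ j ∈ Finset.range n, Sf φ (j + 1) := by
  induction n with
  | zero => simp [Tf]
  | succ n ih => rw [Tf_succ, Finset.sum_range_succ, ih]

lemma Sf_nonneg {φ : ℕ → ℝ} (hp : ∀ n, 0 < φ n) (n : ℕ) : 0 ≤ Sf φ n :=
  Finset.sum_nonneg fun k _ => (hp k).le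

lemma Sf_mono {φ : ℕ → ℝ} (hp : ∀ n, 0 < φ n) : Monotone (Sf φ) := by
  refine monotone_nat_of_le_succ fun n => ?_
  unfold Sf
  rw [Finset.sum_range_succ]
  linarith [hp n]

lemma Tf_nonneg {φ : ℕ → ℝ} (hp : ∀ n, 0 < φ n) (n : ℕ) : 0 ≤ Tf φ n := by
  rw [Tf_eq]
  exact Finset.sum_nonneg fun k _ => Sf_nonneg hp _

lemma Tf_pos {φ : ℕ → ℝ} (hp : ∀ n, 0 < φ n) {n : ℕ} (hn : 0 < n) : 0 < Tf φ n := by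
  unfold Tf
  refine Finset.sum_pos (fun k hk => ?_) ⟨0, by simpa using hn⟩
  have : k < n := Finset.mem_range.1 hk
  have : 0 < n - k := by omega
  have := hp k
  positivity

lemma Sf_tendsto {φ : ℕ → ℝ} (hp : ∀ n, 0 < φ n) (hφ : Tendsto φ atTop atTop) :
    Tendsto (fun n => Sf φ (n + 1)) atTop atTop := by
  refine tendsto_atTop_mono (fun n => ?_) hφ
  unfold Sf
  rw [Finset.sum_range_succ]
  have := Sf_nonneg hp n
  unfold Sf at this
  linarith

lemma n_le_Tf {φ : ℕ → ℝ} (hp : ∀ n, 0 < φ n) (hφ : Tendsto φ atTop atTop) {δ : ℝ} (hδ : 0 < δ) :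
    ∀ᶠ n : ℕ in atTop, (n : ℝ) ≤ δ * Tf φ n := by
  have h1 : (fun _ : ℕ => (1 : ℝ)) =o[atTop] (fun n => Sf φ (n + 1)) := by
    rw [Asymptotics.isLittleO_const_left]
    right
    exact tendsto_norm_atTop_atTop.comp (Sf_tendsto hp hφ)
  have h3 : Tendsto (fun n => ∑ j ∈ Finset.range n, Sf φ (j + 1)) atTop atTop := by
    have : Tendsto (fun n => ∑ j ∈ Finset.range (n+1), Sf φ (j + 1)) atTop atTop := by
      refine tendsto_atTop_mono (fun n => ?_) (Sf_tendsto hp hφ)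
      rw [Finset.sum_range_succ]
      have : 0 ≤ ∑ j ∈ Finset.range n, Sf φ (j + 1) := Finset.sum_nonneg fun k _ => Sf_nonneg hp _
      linarith
    exact (tendsto_add_atTop_iff_nat 1).1 this
  have h2 := h1.sum_range (fun n => Sf_nonneg hp _) h3
  filter_upwards [h2.bound hδ] with n hn
  simp only [Finset.sum_const, Finset.card_range, nsmul_eq_mul, mul_one] at hn
  rw [← Tf_eq, Real.norm_of_nonneg (Nat.cast_nonneg n), Real.norm_of_nonneg (Tf_nonneg hp n)] at hn
  exact hn

lemma Tf_tendsto {φ : ℕ → ℝ} (hp : ∀ n, 0 < φ n) (hφ : Tendsto φ atTop atTop) :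
    Tendsto (Tf φ) atTop atTop := by
  refine tendsto_atTop_mono' _ ?_ (tendsto_natCast_atTop_atTop (R := ℝ))
  filter_upwards [n_le_Tf hp hφ one_pos] with n hn
  simpa using hn

lemma lin_le_Tf {φ : ℕ → ℝ} (hp : ∀ n, 0 < φ n) (hφ : Tendsto φ atTop atTop) (a b : ℝ) {δ : ℝ}
    (hδ : 0 < δ) : ∀ᶠ n : ℕ in atTop, a * n + b ≤ δ * Tf φ n := by
  have h : 0 < δ / 2 / (|a| + 1) := by positivity
  filter_upwards [n_le_Tf hp hφ h, (Tf_tendsto hp hφ).eventually_ge_atTop (|b| / (δ / 2))] with n h1 h2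
  rw [div_le_iff₀ (by positivity)] at h2
  have h3 : (|a| + 1) * n ≤ δ / 2 * Tf φ n := by
    calc (|a| + 1) * n ≤ (|a| + 1) * (δ / 2 / (|a| + 1) * Tf φ n) := by gcongr
      _ = _ := by field_simp
  have h4 : a * n ≤ |a| * n := by gcongr; exact le_abs_self a
  have := le_abs_self b
  have : (0:ℝ) ≤ n := Nat.cast_nonneg n
  linarith

lemma exists_bound {u : ℕ → ℝ} (h : ∀ᶠ n in atTop, u n ≤ 0) : ∃ C : ℝ, 0 ≤ C ∧ ∀ n, u n ≤ C := by
  have : BddAbove (Set.range u) :=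
    (Filter.isBoundedUnder_of_eventually_le h).bddAbove_range
  obtain ⟨C, hC⟩ := this
  exact ⟨max C 0, le_max_right _ _, fun n => (hC ⟨n, rfl⟩).trans (le_max_left _ _)⟩

lemma gamma_eq (φ : ℕ → ℝ) : gammaExp φ =
    limsup (fun n => ENNReal.ofReal (Sf φ (n+1) / Tf φ n)) atTop := rfl

lemma gamma_lower {φ : ℕ → ℝ} (hp : ∀ n, 0 < φ n) {g : ℝ} (hg : ENNReal.ofReal g < gammaExp φ) :
    ∃ᶠ n in atTop, g * Tf φ n ≤ Sf φ (n + 1) := by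
  have h := frequently_lt_of_lt_limsup (by isBoundedDefault) (gamma_eq φ ▸ hg)
  refine (h.and_eventually (eventually_gt_atTop 0)).mono ?_
  rintro n ⟨h1, h2⟩
  have h3 := (ENNReal.ofReal_lt_ofReal_iff'.1 h1).1
  rw [lt_div_iff₀ (Tf_pos hp h2)] at h3
  exact h3.le

lemma gamma_upper {φ : ℕ → ℝ} (hp : ∀ n, 0 < φ n) {g : ℝ} (hg : gammaExp φ < ENNReal.ofReal g) :
    ∀ᶠ n in atTop, Sf φ (n + 1) ≤ g * Tf φ n := by
  have h := eventually_lt_of_limsup_lt (gamma_eq φ ▸ hg) (by isBoundedDefault)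
  filter_upwards [h, eventually_gt_atTop 0] with n h1 h2
  have h3 := (ENNReal.ofReal_lt_ofReal_iff'.1 h1).1
  rw [div_lt_iff₀ (Tf_pos hp h2)] at h3
  exact h3.le

/-- Stolz-type lemma. -/
lemma log_bound {φ : ℕ → ℝ} (hp : ∀ n, 0 < φ n) (hφ : Tendsto φ atTop atTop) {L : ℕ → ℝ}
    (hL : Tendsto (fun n => (L (n + 1) - L n) / φ (n + 1)) atTop (nhds 1)) {ε : ℝ} (hε : 0 < ε) :
    ∃ C : ℝ, 0 ≤ C ∧ ∀ n, |L n - Sf φ (n + 1)| - ε * Sf φ (n + 1) ≤ C := by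
  have h1 : (fun n => L (n + 1) - L n - φ (n + 1)) =o[atTop] (fun n => φ (n + 1)) := by
    rw [Asymptotics.isLittleO_iff_tendsto (fun n hn => absurd hn (hp _).ne')]
    have := hL.sub_const 1
    rw [sub_self] at this
    refine this.congr fun n => ?_
    have := (hp (n+1)).ne'
    field_simp
  have hsum : ∀ n, ∑ k ∈ Finset.range n, φ (k + 1) = Sf φ (n + 1) - φ 0 := by
    intro n
    unfold Sf
    rw [Finset.sum_range_succ']
    ring
  have h3 : Tendsto (fun n => ∑ k ∈ Finset.range n, φ (k + 1)) atTop atTop := by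
    simp only [hsum]
    exact tendsto_atTop_add_const_right _ _ (Sf_tendsto hp hφ)
  have h2 := h1.sum_range (fun n => (hp _).le) h3
  have key : ∀ n, ∑ k ∈ Finset.range n, (L (k + 1) - L k - φ (k + 1)) =
      L n - Sf φ (n + 1) - (L 0 - φ 0) := by
    intro n
    rw [Finset.sum_sub_distrib, Finset.sum_range_sub, hsum]
    ring
  refine exists_bound ?_
  filter_upwards [h2.bound (half_pos hε),
    (Sf_tendsto hp hφ).eventually_ge_atTop (|L 0 - φ 0| / (ε / 2))] with n hn hn2
  rw [key, hsum, Real.norm_eq_abs, Real.norm_eq_abs] at hn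
  rw [div_le_iff₀ (by positivity)] at hn2
  have hS : 0 ≤ Sf φ (n + 1) - φ 0 := by
    rw [← hsum]; exact Finset.sum_nonneg fun k _ => (hp _).le
  rw [abs_of_nonneg hS] at hn
  have := abs_sub_abs_le_abs_sub (L n - Sf φ (n + 1)) (L 0 - φ 0)
  have := hp 0
  nlinarith

def FK (φ : ℕ → ℝ) (ε K : ℝ) : Set ℝ :=
  {x | ∃ e : ℕ → ℕ, GoodD (fun i => (e i : ℝ)) ∧
    (∀ n, Real.exp ((1 - ε) * Sf φ (n + 1)) ≤ K * e n ∧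
      (e n : ℝ) ≤ K * Real.exp ((1 + ε) * Sf φ (n + 1))) ∧
    x = Qs (fun i => (e i : ℝ))}

noncomputable def Dg (φ : ℕ → ℝ) (ε K : ℝ) (i : ℕ) : ℕ :=
  ⌊K * Real.exp ((1 + ε) * Sf φ (i + 1))⌋₊ + 1

def FKt (φ : ℕ → ℝ) (ε K : ℝ) (n : ℕ) (w : (i : Fin n) → Fin (Dg φ ε K i)) : Set ℝ :=
  {x | ∃ e : ℕ → ℕ, GoodD (fun i => (e i : ℝ)) ∧
    (∀ n, Real.exp ((1 - ε) * Sf φ (n + 1)) ≤ K * e n ∧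
      (e n : ℝ) ≤ K * Real.exp ((1 + ε) * Sf φ (n + 1))) ∧
    x = Qs (fun i => (e i : ℝ)) ∧ ∀ i : Fin n, e i = w i}

lemma FK_subset (φ : ℕ → ℝ) (ε K : ℝ) (n : ℕ) : FK φ ε K ⊆ ⋃ w, FKt φ ε K n w := by
  rintro x ⟨e, h1, h2, h3⟩
  refine Set.mem_iUnion.2 ⟨fun i => ⟨e i, ?_⟩, e, h1, h2, h3, fun i => rfl⟩
  exact Nat.lt_succ_of_le (Nat.le_floor (h2 i).2)

lemma prod_exp_Sf (φ : ℕ → ℝ) (K a : ℝ) (n : ℕ) :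
    ∏ i ∈ Finset.range n, (K * Real.exp (a * Sf φ (i + 1))) = K ^ n * Real.exp (a * Tf φ n) := by
  rw [Finset.prod_mul_distrib, Finset.prod_const, Finset.card_range, ← Real.exp_sum,
    ← Finset.mul_sum, Tf_eq]

lemma FKt_diam {φ : ℕ → ℝ} {ε K : ℝ} (hK : 0 < K) (n : ℕ) (w : (i : Fin n) → Fin (Dg φ ε K i)) :
    Metric.ediam (FKt φ ε K n w) ≤
      ENNReal.ofReal (K ^ (n + 1) * Real.exp (-((1 - ε) * (Tf φ n + Sf φ (n + 1))))) := by
  refine Metric.ediam_le ?_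
  rintro x ⟨e, h1, h2, rfl, h4⟩ y ⟨e', h1', h2', rfl, h4'⟩
  rw [edist_dist]
  refine ENNReal.ofReal_le_ofReal ?_
  rw [Real.dist_eq]
  have hr : 0 < K⁻¹ * Real.exp ((1 - ε) * Sf φ (n + 1)) := by positivity
  refine (Q_diff_le (n := n) h1 h1' (fun i hi => ?_) hr ?_ ?_).trans ?_
  · simp only [h4 ⟨i, hi⟩, h4' ⟨i, hi⟩]
  · rw [inv_mul_le_iff₀ hK]; exact (h2 n).1
  · rw [inv_mul_le_iff₀ hK]; exact (h2' n).1
  · have hp : K⁻¹ ^ n * Real.exp ((1 - ε) * Tf φ n) ≤ ∏ i ∈ Finset.range n, (e i : ℝ) := by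
      rw [← prod_exp_Sf]
      refine Finset.prod_le_prod (fun i _ => by positivity) fun i _ => ?_
      rw [inv_mul_le_iff₀ hK]; exact (h2 i).1
    have := one_div_le_one_div_of_le (by positivity) hp
    refine (mul_le_mul_of_nonneg_right this (by positivity)).trans (le_of_eq ?_)
    rw [mul_add, neg_add, Real.exp_add, Real.exp_neg, Real.exp_neg, inv_pow]
    field_simp
    try ring

lemma card_words {φ : ℕ → ℝ} (hp : ∀ n, 0 < φ n) {ε K : ℝ} (hK : 1 ≤ K) (hε : 0 < ε) (n : ℕ) :
    (Fintype.card ((i : Fin n) → Fin (Dg φ ε K i)) : ℝ) ≤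
      (2 * K) ^ n * Real.exp ((1 + ε) * Tf φ n) := by
  rw [Fintype.card_pi]
  simp only [Fintype.card_fin]
  rw [Fin.prod_univ_eq_prod_range (fun i => Dg φ ε K i) n, ← prod_exp_Sf]
  push_cast
  refine Finset.prod_le_prod (fun i _ => by positivity) fun i _ => ?_
  unfold Dg
  push_cast
  have h1 : (1:ℝ) ≤ Real.exp ((1 + ε) * Sf φ (i + 1)) :=
    Real.one_le_exp (mul_nonneg (by linarith) (Sf_nonneg hp _))
  have h2 := Nat.floor_le (by positivity : 0 ≤ K * Real.exp ((1 + ε) * Sf φ (i + 1)))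
  nlinarith

open MeasureTheory in
lemma FK_null {φ : ℕ → ℝ} (hp : ∀ n, 0 < φ n) (hφ : Tendsto φ atTop atTop) {ε K s g δ : ℝ}
    (hK : 1 ≤ K) (hε : 0 < ε) (hε1 : ε < 1) (hs : 0 < s) (hδ : 0 < δ)
    (hs1 : 1 + ε + 2 * δ ≤ s * (1 - ε) * (1 + g))
    (hg : ∃ᶠ n in atTop, g * Tf φ n ≤ Sf φ (n + 1)) :
    μH[s] (FK φ ε K) = 0 := by
  have hK0 : 0 < K := by linarith
  obtain ⟨ψ, hψ, hψg⟩ := extraction_of_frequently_atTop hg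
  have hψt := hψ.tendsto_atTop
  set r : ℕ → ℝ := fun n => K ^ (n + 1) * Real.exp (-((1 - ε) * (Tf φ n + Sf φ (n + 1)))) with hr
  have rpos : ∀ n, 0 < r n := fun n => by positivity
  have rexp : ∀ n, r n = Real.exp ((n + 1) * Real.log K - (1 - ε) * (Tf φ n + Sf φ (n + 1))) := by
    intro n
    rw [sub_eq_add_neg, Real.exp_add, hr]
    simp only
    congr 1
    rw [← Nat.cast_succ, Real.exp_nat_mul, Real.exp_log hK0]
  have r0 : Tendsto r atTop (nhds 0) := by
    have h1 : Tendsto (fun n => Real.exp (-((1 - ε) / 2 * Tf φ n))) atTop (nhds 0) := by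
      refine Real.tendsto_exp_atBot.comp (tendsto_neg_atTop_atBot.comp ?_)
      exact (Tf_tendsto hp hφ).const_mul_atTop (by linarith)
    refine squeeze_zero' (.of_forall fun n => (rpos n).le) ?_ h1
    filter_upwards [lin_le_Tf hp hφ (Real.log K) (Real.log K)
      (by linarith : 0 < (1 - ε) / 2)] with n hn
    rw [rexp]
    refine Real.exp_le_exp.2 ?_
    have := mul_nonneg (by linarith : 0 ≤ 1 - ε) (Sf_nonneg hp (n+1))
    linarith
  have hsum : Tendsto (fun n => (2 * K) ^ (ψ n) * Real.exp ((1 + ε) * Tf φ (ψ n)) * r (ψ n) ^ s)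
      atTop (nhds 0) := by
    have h1 : Tendsto (fun n => Real.exp (-(δ * Tf φ (ψ n)))) atTop (nhds 0) := by
      refine Real.tendsto_exp_atBot.comp (tendsto_neg_atTop_atBot.comp ?_)
      exact ((Tf_tendsto hp hφ).const_mul_atTop hδ).comp hψt
    refine squeeze_zero' (.of_forall fun n => ?_) ?_ h1
    · have := rpos (ψ n)
      positivity
    filter_upwards [hψt.eventually (lin_le_Tf hp hφ (Real.log (2 * K) + s * Real.log K)
      (s * Real.log K) hδ)] with n hn
    rw [rexp, ← Real.exp_mul, ← Real.exp_log (by positivity : 0 < 2 * K), ← Real.exp_nat_mul,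
      ← Real.exp_add, ← Real.exp_add]
    refine Real.exp_le_exp.2 ?_
    have hT := Tf_nonneg hp (ψ n)
    have h3 := mul_le_mul_of_nonneg_left (hψg n)
      (mul_nonneg hs.le (by linarith : 0 ≤ 1 - ε))
    have h4 := mul_le_mul_of_nonneg_right hs1 hT
    nlinarith
  have key := Measure.hausdorffMeasure_le_liminf_sum (ι := fun n => (i : Fin (ψ n)) → Fin (Dg φ ε K i))
    s (FK φ ε K) (l := atTop) (fun n => ENNReal.ofReal (r (ψ n)))
    (by simpa using ENNReal.tendsto_ofReal (r0.comp hψt)) (fun n w => FKt φ ε K (ψ n) w)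
    (.of_forall fun n w => FKt_diam hK0 _ w) (.of_forall fun n => FK_subset φ ε K (ψ n))
  refine le_antisymm (key.trans ?_) bot_le
  have h2 : Tendsto (fun n => ENNReal.ofReal ((2 * K) ^ (ψ n) * Real.exp ((1 + ε) * Tf φ (ψ n)) *
      r (ψ n) ^ s)) atTop (nhds 0) := by simpa using ENNReal.tendsto_ofReal hsum
  rw [← h2.liminf_eq]
  refine liminf_le_liminf (.of_forall fun n => ?_)
  have hb : ∀ w, Metric.ediam (FKt φ ε K (ψ n) w) ^ s ≤ ENNReal.ofReal (r (ψ n) ^ s) := by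
    intro w
    rw [← ENNReal.ofReal_rpow_of_pos (rpos _)]
    exact ENNReal.rpow_le_rpow (FKt_diam hK0 _ w) hs.le
  refine (Finset.sum_le_sum fun w _ => hb w).trans ?_
  rw [Finset.sum_const, Finset.card_univ, nsmul_eq_mul, ENNReal.ofReal_mul (by positivity)]
  gcongr
  rw [← ENNReal.ofReal_natCast]
  exact ENNReal.ofReal_le_ofReal (card_words hp hK hε _)

lemma dimH_upper {φ : ℕ → ℝ} (hp : ∀ n, 0 < φ n) (hφ : Tendsto φ atTop atTop) {E : Set ℝ}
    (hE : ∀ x ∈ E, ∃ e : ℕ → ℕ, GoodD (fun i => (e i : ℝ)) ∧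
      Tendsto (fun n : ℕ => Real.log ((e (n + 1) : ℝ) / (e n : ℝ)) / φ (n + 1)) atTop (nhds 1) ∧
      x = Qs (fun i => (e i : ℝ))) {s g : ℝ} (hs : 0 < s) (hsg : 1 < s * (1 + g))
    (hg : ∃ᶠ n in atTop, g * Tf φ n ≤ Sf φ (n + 1)) : dimH E ≤ ENNReal.ofReal s := by
  set a := s * (1 + g)
  set ε := (a - 1) / (2 * (a + 1)) with hεd
  have hε : 0 < ε := div_pos (by linarith) (by linarith)
  have hε2 : ε * (a + 1) = (a - 1) / 2 := by rw [hεd]; field_simp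
  have hε1 : ε < 1 := by
    rw [hεd, div_lt_one (by linarith)]; linarith
  have hsub : E ⊆ ⋃ K : ℕ, FK φ ε ((K : ℝ) + 1) := by
    intro x hx
    obtain ⟨e, h1, h2, rfl⟩ := hE x hx
    have hlog : ∀ n, Real.log ((e (n + 1) : ℝ) / (e n : ℝ)) = Real.log (e (n+1)) - Real.log (e n) :=
      fun n => Real.log_div (h1.pos _).ne' (h1.pos _).ne'
    simp only [hlog] at h2
    obtain ⟨C, hC, hb⟩ := log_bound hp hφ (L := fun n => Real.log (e n)) h2 hε
    obtain ⟨K, hK⟩ := exists_nat_ge (Real.exp C)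
    refine Set.mem_iUnion.2 ⟨K, e, h1, fun n => ?_, rfl⟩
    have hn := hb n
    have hab := abs_le.1 (le_refl |Real.log (e n) - Sf φ (n + 1)|)
    have hpos := h1.pos n
    constructor
    · calc Real.exp ((1 - ε) * Sf φ (n + 1)) ≤ Real.exp (C + Real.log (e n)) :=
            Real.exp_le_exp.2 (by linarith)
        _ = Real.exp C * e n := by rw [Real.exp_add, Real.exp_log hpos]
        _ ≤ (K + 1) * e n := by gcongr; linarith
    · calc (e n : ℝ) = Real.exp (Real.log (e n)) := (Real.exp_log hpos).symm
        _ ≤ Real.exp (C + (1 + ε) * Sf φ (n + 1)) := Real.exp_le_exp.2 (by linarith)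
        _ = Real.exp C * Real.exp ((1 + ε) * Sf φ (n + 1)) := by rw [Real.exp_add]
        _ ≤ (K + 1) * Real.exp ((1 + ε) * Sf φ (n + 1)) := by gcongr; linarith
  refine (dimH_mono hsub).trans ?_
  rw [dimH_iUnion]
  refine iSup_le fun K => ?_
  have := FK_null hp hφ (ε := ε) (K := (K:ℝ) + 1) (s := s) (g := g) (δ := (a - 1) / 4)
    (by have : (0:ℝ) ≤ K := Nat.cast_nonneg K
        linarith) hε hε1 hs (by linarith) (by
      have : s * (1 - ε) * (1 + g) = a * (1 - ε) := by ring
      rw [this]; linarith) hg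
  have h2 := dimH_le_of_hausdorffMeasure_ne_top (d := s.toNNReal) (s := FK φ ε ((K:ℝ) + 1))
    (by rw [Real.coe_toNNReal _ hs.le, this]; simp)
  exact h2

lemma dimH_of_inv_holder {g : ℝ → ℝ} {A : Set ℝ} {C s : ℝ} (hC : 0 ≤ C) (hs : 0 < s)
    (h : ∀ t ∈ A, ∀ t' ∈ A, |t - t'| ≤ C * |g t - g t'| ^ s) :
    dimH A ≤ dimH (g '' A) / ENNReal.ofReal s := by
  have hinj : Set.InjOn g A := by
    intro t ht t' ht' he
    have := h t ht t' ht'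
    rw [he, sub_self, abs_zero, Real.zero_rpow hs.ne', mul_zero] at this
    exact sub_eq_zero.1 (abs_nonpos_iff.1 this)
  have hl : ∀ t ∈ A, Function.invFunOn g A (g t) = t := fun t ht => hinj.leftInvOn_invFunOn ht
  have hh : HolderOnWith C.toNNReal s.toNNReal (Function.invFunOn g A) (g '' A) := by
    rintro x ⟨t, ht, rfl⟩ y ⟨t', ht', rfl⟩
    rw [hl t ht, hl t' ht', edist_dist, edist_dist, Real.dist_eq, Real.dist_eq,
      Real.coe_toNNReal _ hs.le, ENNReal.ofReal_rpow_of_nonneg (abs_nonneg _) hs.le]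
    change _ ≤ ENNReal.ofReal C * _
    rw [← ENNReal.ofReal_mul hC]
    exact ENNReal.ofReal_le_ofReal (h t ht t' ht')
  have := hh.dimH_image_le (Real.toNNReal_pos.2 hs)
  rwa [hinj.leftInvOn_invFunOn.image_image] at this

noncomputable def Bn (φ : ℕ → ℝ) (n : ℕ) : ℕ := 4 ^ n * ⌈Real.exp (Sf φ (n + 1))⌉₊
noncomputable def Pn (φ : ℕ → ℝ) (n : ℕ) : ℕ := ∏ i ∈ Finset.range n, Bn φ i
noncomputable def qn (φ : ℕ → ℝ) (t : ℝ) (n : ℕ) : ℕ := ⌊(Pn φ n : ℝ) * t⌋₊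
noncomputable def dn (φ : ℕ → ℝ) (t : ℝ) (n : ℕ) : ℕ := Bn φ n + (qn φ t (n + 1) - Bn φ n * qn φ t n)

lemma Bn_pos (φ : ℕ → ℝ) (n : ℕ) : 1 ≤ Bn φ n := by
  have : 0 < ⌈Real.exp (Sf φ (n + 1))⌉₊ := Nat.ceil_pos.2 (Real.exp_pos _)
  unfold Bn
  exact Nat.succ_le_of_lt (by positivity)

lemma Bn_succ {φ : ℕ → ℝ} (hp : ∀ n, 0 < φ n) (n : ℕ) : 4 * Bn φ n ≤ Bn φ (n + 1) := by
  unfold Bn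
  rw [pow_succ, mul_comm _ 4, mul_assoc]
  gcongr
  exact Sf_mono hp (by omega)

lemma Pn_succ (φ : ℕ → ℝ) (n : ℕ) : Pn φ (n + 1) = Pn φ n * Bn φ n := Finset.prod_range_succ _ _

lemma Pn_pos (φ : ℕ → ℝ) (n : ℕ) : 1 ≤ Pn φ n :=
  Nat.succ_le_of_lt (Finset.prod_pos fun i _ => Bn_pos φ i)

lemma q_le {φ : ℕ → ℝ} {t : ℝ} (ht : 0 ≤ t) (n : ℕ) :
    Bn φ n * qn φ t n ≤ qn φ t (n + 1) := by
  unfold qn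
  refine Nat.le_floor ?_
  push_cast [Pn_succ]
  have := Nat.floor_le (by positivity : 0 ≤ (Pn φ n : ℝ) * t)
  calc (Bn φ n : ℝ) * ⌊(Pn φ n : ℝ) * t⌋₊ ≤ Bn φ n * ((Pn φ n : ℝ) * t) := by gcongr
    _ = _ := by ring

lemma q_lt {φ : ℕ → ℝ} {t : ℝ} (ht : 0 ≤ t) (n : ℕ) :
    qn φ t (n + 1) < Bn φ n * qn φ t n + Bn φ n := by
  unfold qn
  rw [Nat.floor_lt (by positivity)]
  push_cast [Pn_succ]
  have := Nat.lt_floor_add_one ((Pn φ n : ℝ) * t)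
  have hB : (0:ℝ) < Bn φ n := by exact_mod_cast Bn_pos φ n
  calc (Pn φ n : ℝ) * Bn φ n * t = Bn φ n * ((Pn φ n : ℝ) * t) := by ring
    _ < Bn φ n * ((⌊(Pn φ n : ℝ) * t⌋₊ : ℝ) + 1) := by gcongr
    _ = _ := by ring

lemma d_ge (φ : ℕ → ℝ) (t : ℝ) (n : ℕ) : Bn φ n ≤ dn φ t n := Nat.le_add_right _ _

lemma d_lt {φ : ℕ → ℝ} {t : ℝ} (ht : 0 ≤ t) (n : ℕ) : dn φ t n < 2 * Bn φ n := by
  have := q_lt (φ := φ) ht n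
  have := Bn_pos φ n
  unfold dn
  omega

lemma d_mono {φ : ℕ → ℝ} (hp : ∀ n, 0 < φ n) {t : ℝ} (ht : 0 ≤ t) : StrictMono (dn φ t) := by
  refine strictMono_nat_of_lt_succ fun n => ?_
  have := d_lt (φ := φ) ht n
  have := d_ge φ t (n + 1)
  have := Bn_succ hp n
  omega

lemma d_good {φ : ℕ → ℝ} (hp : ∀ n, 0 < φ n) {t : ℝ} (ht : 0 ≤ t) :
    GoodD (fun i => (dn φ t i : ℝ)) := by
  have h := goodD_of (c := fun i => dn φ t i + 1) ((d_mono hp ht).add_const 1)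
    (by have := d_ge φ t 0; have := Bn_pos φ 0; omega)
  simpa using h

lemma log_Pn (φ : ℕ → ℝ) (n : ℕ) : Tf φ n ≤ Real.log (Pn φ n) := by
  have : Real.exp (Tf φ n) ≤ Pn φ n := by
    have := prod_exp_Sf φ 1 1 n
    simp only [one_mul, one_pow] at this
    rw [← this]
    unfold Pn
    push_cast
    refine Finset.prod_le_prod (fun i _ => (Real.exp_pos _).le) fun i _ => ?_
    unfold Bn
    push_cast
    calc Real.exp (Sf φ (i + 1)) ≤ 1 * ⌈Real.exp (Sf φ (i + 1))⌉₊ := by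
          rw [one_mul]; exact Nat.le_ceil _
      _ ≤ _ := by gcongr; exact one_le_pow₀ (by norm_num)
  rw [Real.le_log_iff_exp_le (by exact_mod_cast Pn_pos φ n)]
  exact this

lemma Bn_ge (φ : ℕ → ℝ) (n : ℕ) : Real.exp (Sf φ (n + 1)) ≤ Bn φ n := by
  unfold Bn
  push_cast
  calc Real.exp (Sf φ (n + 1)) ≤ 1 * ⌈Real.exp (Sf φ (n + 1))⌉₊ := by
        rw [one_mul]; exact Nat.le_ceil _
    _ ≤ _ := by gcongr; exact one_le_pow₀ (by norm_num)

lemma Bn_le {φ : ℕ → ℝ} (hp : ∀ n, 0 < φ n) (n : ℕ) :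
    (Bn φ n : ℝ) ≤ 4 ^ n * (2 * Real.exp (Sf φ (n + 1))) := by
  unfold Bn
  push_cast
  gcongr
  have := Nat.ceil_lt_add_one (Real.exp_pos (Sf φ (n + 1))).le
  have := Real.one_le_exp (Sf_nonneg hp (n+1))
  linarith

lemma log_Bn_le {φ : ℕ → ℝ} (hp : ∀ n, 0 < φ n) (n : ℕ) :
    Real.log (Bn φ n) ≤ n * Real.log 4 + Real.log 2 + Sf φ (n + 1) := by
  have hB : (0:ℝ) < Bn φ n := by exact_mod_cast Bn_pos φ n
  refine (Real.log_le_log hB (Bn_le hp n)).trans (le_of_eq ?_)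
  rw [Real.log_mul (by positivity) (by positivity), Real.log_mul (by positivity) (by positivity),
    Real.log_pow, Real.log_exp]
  ring

lemma holder_main {φ : ℕ → ℝ} (hp : ∀ n, 0 < φ n) (hφ : Tendsto φ atTop atTop) {s g : ℝ}
    (hs : 0 < s) (hg0 : 0 ≤ g) (hsg : s * (1 + g) < 1)
    (hg : ∀ᶠ n in atTop, Sf φ (n + 1) ≤ g * Tf φ n) :
    ∃ C : ℝ, 0 ≤ C ∧ ∀ n : ℕ, ∀ m : ℝ, 1 ≤ m → m ≤ Bn φ n →
      2 * m / Pn φ (n + 1) ≤ C * (1 / (2 ^ n * (Pn φ n : ℝ)) * (m / (8 * (Bn φ n : ℝ) ^ 2))) ^ s := by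
  have hs1 : s < 1 := by nlinarith
  obtain ⟨C, -, hC⟩ := exists_bound (u := fun n : ℕ => Real.log 2 - Real.log (Pn φ n) +
    s * (n * Real.log 2 + Real.log 8 + Real.log (Pn φ n) + Real.log (Bn φ n))) (by
    filter_upwards [hg, lin_le_Tf hp hφ (s * Real.log 2 + s * Real.log 4)
      (Real.log 2 + s * Real.log 8 + s * Real.log 2)
      (by linarith : 0 < 1 - s * (1 + g))] with n h1 h2
    have h3 := mul_le_mul_of_nonneg_left (log_Bn_le hp n) hs.le
    have h4 := mul_le_mul_of_nonneg_left (log_Pn φ n) (by linarith : 0 ≤ 1 - s)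
    have h5 := mul_le_mul_of_nonneg_left h1 hs.le
    linarith)
  refine ⟨Real.exp C, (Real.exp_pos _).le, fun n m hm hmB => ?_⟩
  have hB : (0:ℝ) < Bn φ n := by exact_mod_cast Bn_pos φ n
  have hP : (0:ℝ) < Pn φ n := by exact_mod_cast Pn_pos φ n
  have hm0 : 0 < m := by linarith
  rw [Real.rpow_def_of_pos (by positivity), ← Real.exp_add, Pn_succ]
  push_cast
  rw [← Real.log_le_iff_le_exp (by positivity), Real.log_div (by positivity) (by positivity),
    Real.log_mul (by positivity) (by positivity), Real.log_mul (by positivity) (by positivity),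
    Real.log_mul (by positivity) (by positivity), Real.log_div (by positivity) (by positivity),
    Real.log_div (by positivity) (by positivity), Real.log_mul (by positivity) (by positivity),
    Real.log_mul (by positivity) (by positivity), Real.log_pow, Real.log_pow, Real.log_one]
  have h1 := mul_le_mul_of_nonneg_left (Real.log_le_log hm0 hmB) (by linarith : 0 ≤ 1 - s)
  have h2 := hC n
  push_cast
  nlinarith

noncomputable def gm (φ : ℕ → ℝ) (t : ℝ) : ℝ := Qs (fun i => (dn φ t i : ℝ))

lemma first_diff {φ : ℕ → ℝ} (hp : ∀ n, 0 < φ n) {t t' : ℝ} (ht : t ∈ Set.Ico (0:ℝ) 1)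
    (ht' : t' ∈ Set.Ico (0:ℝ) 1) (hne : t ≠ t') :
    ∃ n, (∀ i ≤ n, qn φ t i = qn φ t' i) ∧ qn φ t (n + 1) ≠ qn φ t' (n + 1) := by
  classical
  have hex : ∃ n, qn φ t n ≠ qn φ t' n := by
    by_contra! hall
    have hlt : ∀ n : ℕ, (n : ℝ) * |t - t'| ≤ 1 := by
      intro n
      have hq := hall n
      unfold qn at hq
      have a1 := Nat.floor_le (by have := ht.1; positivity : 0 ≤ (Pn φ n : ℝ) * t)
      have a2 := Nat.lt_floor_add_one ((Pn φ n : ℝ) * t)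
      have b1 := Nat.floor_le (by have := ht'.1; positivity : 0 ≤ (Pn φ n : ℝ) * t')
      have b2 := Nat.lt_floor_add_one ((Pn φ n : ℝ) * t')
      rw [hq] at a1 a2
      have h3 : (Pn φ n : ℝ) * |t - t'| ≤ 1 := by
        rw [← abs_of_nonneg (Nat.cast_nonneg (Pn φ n) : (0:ℝ) ≤ Pn φ n), ← abs_mul, abs_le]
        constructor <;> nlinarith
      have h4 : n ≤ Pn φ n := by
        clear * - hp
        induction n with
        | zero => simp
        | succ k ih =>
          rw [Pn_succ]
          have h1 := Pn_pos φ k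
          have h2 : 2 ≤ Bn φ k ∨ k = 0 := by
            rcases k with _ | k
            · right; rfl
            · left; have := Bn_succ hp k; have := Bn_pos φ k; omega
          rcases h2 with h2 | rfl
          · nlinarith
          · have := Bn_pos φ 0; nlinarith
      have h5 : (n : ℝ) ≤ Pn φ n := by exact_mod_cast h4
      exact (mul_le_mul_of_nonneg_right h5 (abs_nonneg _)).trans h3
    have hpos : 0 < |t - t'| := abs_pos.2 (sub_ne_zero.2 hne)
    obtain ⟨n, hn⟩ := exists_nat_gt (1 / |t - t'|)
    rw [div_lt_iff₀ hpos] at hn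
    linarith [hlt n]
  have h0 : qn φ t 0 = qn φ t' 0 := by
    simp only [qn, Pn, Finset.range_zero, Finset.prod_empty, Nat.cast_one, one_mul]
    rw [Nat.floor_eq_zero.2 ht.2, Nat.floor_eq_zero.2 ht'.2]
  have hsp := Nat.find_spec hex
  have hmin := fun i (hi : i < Nat.find hex) => Nat.find_min hex hi
  rcases hN : Nat.find hex with _ | n
  · rw [hN] at hsp; exact absurd h0 hsp
  · rw [hN] at hsp hmin
    exact ⟨n, fun i hi => not_not.1 (hmin i (by omega)), hsp⟩

lemma gm_holder_aux {φ : ℕ → ℝ} (hp : ∀ n, 0 < φ n) {s C : ℝ} (hs : 0 < s) (hC0 : 0 ≤ C)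
    (hC : ∀ n : ℕ, ∀ m : ℝ, 1 ≤ m → m ≤ Bn φ n →
      2 * m / Pn φ (n + 1) ≤ C * (1 / (2 ^ n * (Pn φ n : ℝ)) * (m / (8 * (Bn φ n : ℝ) ^ 2))) ^ s)
    {t t' : ℝ} (ht : 0 ≤ t) (ht' : 0 ≤ t') {n : ℕ}
    (h1 : ∀ i ≤ n, qn φ t i = qn φ t' i) (h2 : qn φ t (n + 1) < qn φ t' (n + 1)) :
    |t - t'| ≤ C * |gm φ t - gm φ t'| ^ s := by
  have hB : (0:ℝ) < Bn φ n := by exact_mod_cast Bn_pos φ n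
  have hP : (0:ℝ) < Pn φ n := by exact_mod_cast Pn_pos φ n
  have hP1 : (0:ℝ) < Pn φ (n+1) := by exact_mod_cast Pn_pos φ (n+1)
  have hde : ∀ i < n, dn φ t i = dn φ t' i := by
    intro i hi
    unfold dn
    rw [h1 i hi.le, h1 (i+1) hi]
  obtain ⟨k, hk⟩ := Nat.exists_eq_add_of_lt h2
  have hq := h1 n le_rfl
  have l1 := q_le (φ := φ) ht n
  have l2 := q_le (φ := φ) ht' n
  have l3 := q_lt (φ := φ) ht' n
  have hdd : dn φ t' n = dn φ t n + (k + 1) := by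
    unfold dn; rw [hq] at l1 ⊢; omega
  have hkB : k + 1 ≤ Bn φ n := by rw [hq] at l1; omega
  set m : ℝ := ((k + 1 : ℕ) : ℝ) with hm
  have hm1 : 1 ≤ m := by rw [hm]; exact_mod_cast Nat.succ_le_succ (Nat.zero_le k)
  have hmB : m ≤ Bn φ n := by rw [hm]; exact_mod_cast hkB
  have htt : |t - t'| ≤ 2 * m / Pn φ (n + 1) := by
    rw [le_div_iff₀ hP1]
    have a1 := Nat.floor_le (by positivity : 0 ≤ (Pn φ (n+1) : ℝ) * t)
    have a2 := Nat.lt_floor_add_one ((Pn φ (n+1) : ℝ) * t)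
    have b1 := Nat.floor_le (by positivity : 0 ≤ (Pn φ (n+1) : ℝ) * t')
    have b2 := Nat.lt_floor_add_one ((Pn φ (n+1) : ℝ) * t')
    have e : (⌊(Pn φ (n+1) : ℝ) * t'⌋₊ : ℝ) = ⌊(Pn φ (n+1) : ℝ) * t⌋₊ + m := by
      rw [hm]
      unfold qn at hk
      exact_mod_cast hk
    rw [← abs_of_pos hP1, ← abs_mul, abs_le]
    constructor <;> nlinarith
  refine htt.trans ((hC n m hm1 hmB).trans ?_)
  have hg := d_good hp ht
  have hg' := d_good hp ht'
  have hgap := Q_gap (hg.shift n) (hg'.shift n) (m := m) (B := Bn φ n) hm1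
    (by simp only [zero_add]; rw [hdd, hm]; push_cast; linarith)
    (by simp only [zero_add]; exact_mod_cast (d_lt (φ := φ) ht' n).le)
    (by simp only [add_comm 1 n]
        exact_mod_cast (Bn_succ hp n).trans (d_ge φ t (n+1)))
  have hprod : ∏ i ∈ Finset.range n, (dn φ t i : ℝ) ≤ 2 ^ n * Pn φ n := by
    have : (2:ℝ) ^ n * Pn φ n = ∏ i ∈ Finset.range n, (2 * (Bn φ i : ℝ)) := by
      rw [Finset.prod_mul_distrib, Finset.prod_const, Finset.card_range]
      unfold Pn; push_cast; rfl
    rw [this]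
    refine Finset.prod_le_prod (fun i _ => by positivity) fun i _ => ?_
    exact_mod_cast (d_lt (φ := φ) ht i).le
  have hpp := hg.prod_pos n
  gcongr
  unfold gm
  rw [Q_diff (n := n) hg hg' (fun i hi => by simp only [hde i hi])]
  have hm0 : 0 < m := by linarith
  refine mul_le_mul (one_div_le_one_div_of_le hpp hprod) (hgap.trans (le_abs_self _))
    (by positivity) (by positivity)

lemma dimH_gm {φ : ℕ → ℝ} (hp : ∀ n, 0 < φ n) (hφ : Tendsto φ atTop atTop) {s g : ℝ}
    (hs : 0 < s) (hg0 : 0 ≤ g) (hsg : s * (1 + g) < 1)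
    (hg : ∀ᶠ n in atTop, Sf φ (n + 1) ≤ g * Tf φ n) :
    ENNReal.ofReal s ≤ dimH (gm φ '' Set.Ico 0 1) := by
  obtain ⟨C, hC0, hC⟩ := holder_main hp hφ hs hg0 hsg hg
  have h := dimH_of_inv_holder (g := gm φ) (A := Set.Ico 0 1) hC0 hs (by
    intro t ht t' ht'
    by_cases hne : t = t'
    · subst hne
      simp only [sub_self, abs_zero]
      positivity
    obtain ⟨n, h1, h2⟩ := first_diff hp ht ht' hne
    rcases lt_or_gt_of_ne h2 with h2 | h2
    · exact gm_holder_aux hp hs hC0 hC ht.1 ht'.1 h1 h2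
    · rw [abs_sub_comm, abs_sub_comm (gm φ t)]
      exact gm_holder_aux hp hs hC0 hC ht'.1 ht.1 (fun i hi => (h1 i hi).symm) h2)
  have hone : dimH (Set.Ico (0:ℝ) 1) = 1 := by
    rw [Real.dimH_of_nonempty_interior (by simp)]
    simp
  rw [hone, ENNReal.le_div_iff_mul_le (by simp [hs]) (by simp), one_mul] at h
  exact h

lemma tendsto_of_bdd {φ : ℕ → ℝ} (hp : ∀ n, 0 < φ n) (hφ : Tendsto φ atTop atTop) {u v : ℕ → ℝ}
    {C : ℝ} (h : ∀ n, |u n - v n| ≤ C)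
    (hu : Tendsto (fun n => u n / φ (n + 1)) atTop (nhds 1)) :
    Tendsto (fun n => v n / φ (n + 1)) atTop (nhds 1) := by
  have h1 : Tendsto (fun n => C / φ (n + 1)) atTop (nhds 0) :=
    (hφ.comp (tendsto_add_atTop_nat 1)).const_div_atTop C
  have h2 : Tendsto (fun n => (u n - v n) / φ (n + 1)) atTop (nhds 0) := by
    refine squeeze_zero_norm (fun n => ?_) h1
    rw [norm_div, Real.norm_eq_abs, Real.norm_of_nonneg (hp _).le]
    exact div_le_div_of_nonneg_right (h n) (hp _).le
  have := hu.sub h2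
  rw [sub_zero] at this
  refine this.congr fun n => ?_
  rw [← sub_div]
  congr 1
  ring

lemma dn_tendsto {φ : ℕ → ℝ} (hp : ∀ n, 0 < φ n) (hφ : Tendsto φ atTop atTop) {t : ℝ}
    (ht : 0 ≤ t) :
    Tendsto (fun n : ℕ => Real.log ((dn φ t (n + 1) : ℝ) / (dn φ t n : ℝ)) / φ (n + 1)) atTop
      (nhds 1) := by
  have hone : Tendsto (fun n => φ (n + 1) / φ (n + 1)) atTop (nhds 1) := by
    simp only [div_self (hp _).ne']
    exact tendsto_const_nhds
  have hpos := (d_good hp ht).pos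
  have lo : ∀ n : ℕ, n * Real.log 4 + Sf φ (n + 1) ≤ Real.log (dn φ t n) := by
    intro n
    have h1 : (4:ℝ) ^ n * Real.exp (Sf φ (n + 1)) ≤ dn φ t n := by
      have : (Bn φ n : ℝ) ≤ dn φ t n := by exact_mod_cast d_ge φ t n
      refine le_trans ?_ this
      unfold Bn
      push_cast
      gcongr
      exact Nat.le_ceil _
    have h2 := Real.log_le_log (by positivity) h1
    rwa [Real.log_mul (by positivity) (by positivity), Real.log_pow, Real.log_exp] at h2
  have hi : ∀ n : ℕ, Real.log (dn φ t n) ≤ Real.log 2 + (n * Real.log 4 + Real.log 2 + Sf φ (n + 1)) := by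
    intro n
    have h1 : (dn φ t n : ℝ) ≤ 2 * Bn φ n := by exact_mod_cast (d_lt ht n).le
    have h2 := Real.log_le_log (hpos n) h1
    have hB : (Bn φ n : ℝ) ≠ 0 := by have := Bn_pos φ n; positivity
    rw [Real.log_mul (by norm_num) hB] at h2
    linarith [log_Bn_le hp n]
  refine tendsto_of_bdd hp hφ (C := 2 * Real.log 2 + Real.log 4) (fun n => ?_) hone
  rw [Real.log_div (hpos _).ne' (hpos _).ne']
  have a1 := lo n
  have a2 := lo (n+1)
  have b1 := hi n
  have b2 := hi (n+1)
  have hS : Sf φ (n + 1 + 1) = Sf φ (n + 1) + φ (n + 1) := Finset.sum_range_succ _ _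
  rw [hS] at a2 b2
  push_cast at a2 b2
  have : 0 < Real.log 4 := Real.log_pos (by norm_num)
  have : 0 < Real.log 2 := Real.log_pos (by norm_num)
  rw [abs_le]
  constructor <;> linarith

lemma log_c_bdd {c : ℕ → ℕ} (hc : GoodD (fun i => (c i : ℝ) - 1)) (n : ℕ) :
    |Real.log ((c (n + 1) : ℝ) / (c n : ℝ)) -
      Real.log (((c (n + 1) : ℝ) - 1) / ((c n : ℝ) - 1))| ≤ Real.log 2 := by
  have key : ∀ i, Real.log ((c i : ℝ) - 1) ≤ Real.log (c i) ∧
      Real.log (c i) ≤ Real.log 2 + Real.log ((c i : ℝ) - 1) := by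
    intro i
    have h1 := hc.pos i
    have h2 := hc i
    have h3 : (0:ℝ) ≤ i := Nat.cast_nonneg i
    simp only at h1 h2
    refine ⟨Real.log_le_log h1 (by linarith), ?_⟩
    rw [← Real.log_mul (by norm_num) h1.ne']
    exact Real.log_le_log (by linarith) (by linarith)
  have h1 : ∀ i, (c i : ℝ) - 1 ≠ 0 := fun i => (hc.pos i).ne'
  have h2 : ∀ i, (c i : ℝ) ≠ 0 := fun i => by
    have := hc.pos i
    exact ne_of_gt (by linarith)
  rw [Real.log_div (h2 _) (h2 _), Real.log_div (h1 _) (h1 _), abs_le]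
  have a := key n
  have b := key (n+1)
  constructor <;> linarith

lemma dimH_main {φ : ℕ → ℝ} (hp : ∀ n, 0 < φ n) (hφ : Tendsto φ atTop atTop) {E : Set ℝ}
    (hE : ∀ x ∈ E, ∃ e : ℕ → ℕ, GoodD (fun i => (e i : ℝ)) ∧
      Tendsto (fun n : ℕ => Real.log ((e (n + 1) : ℝ) / (e n : ℝ)) / φ (n + 1)) atTop (nhds 1) ∧
      x = Qs (fun i => (e i : ℝ)))
    (hsub : gm φ '' Set.Ico 0 1 ⊆ E) : dimH E = 1 / (1 + gammaExp φ) := by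
  have hmul : ∀ s : ℝ, 0 < s → ENNReal.ofReal s * ENNReal.ofReal (1 / s) = 1 := by
    intro s hs
    rw [← ENNReal.ofReal_mul hs.le, mul_one_div_cancel hs.ne', ENNReal.ofReal_one]
  apply le_antisymm
  · by_cases h0 : gammaExp φ = 0
    · rw [h0, add_zero, div_one]
      exact (dimH_mono (Set.subset_univ _)).trans Real.dimH_univ.le
    refine le_of_forall_gt fun s hs => ?_
    obtain ⟨s', hs', hss⟩ := ENNReal.lt_iff_exists_nnreal_btwn.1 hs
    refine lt_of_le_of_lt ?_ hss
    have hspos : (0:ℝ) < s' := by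
      have : (0 : ℝ≥0∞) < s' := lt_of_le_of_lt bot_le hs'
      exact_mod_cast this
    have hcoe : (s' : ℝ≥0∞) = ENNReal.ofReal (s' : ℝ) := by simp
    have h1 : 1 < (s' : ℝ≥0∞) * (1 + gammaExp φ) := by
      rwa [ENNReal.div_lt_iff (by simp) (by simp)] at hs'
    have h2 : ENNReal.ofReal (1 / s' - 1) < gammaExp φ := by
      rcases le_total (1 / (s' : ℝ) - 1) 0 with h | h
      · rw [ENNReal.ofReal_of_nonpos h]
        exact pos_iff_ne_zero.2 h0
      · by_contra! hcon
        have : 1 + gammaExp φ ≤ ENNReal.ofReal (1 / s') := by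
          calc 1 + gammaExp φ ≤ ENNReal.ofReal 1 + ENNReal.ofReal (1 / s' - 1) := by
                rw [ENNReal.ofReal_one]; gcongr
            _ = ENNReal.ofReal (1 / s') := by
                rw [← ENNReal.ofReal_add zero_le_one h]; congr 1; ring
        have h3 : (s' : ℝ≥0∞) * (1 + gammaExp φ) ≤ 1 := by
          refine le_trans ?_ (hmul s' hspos).le
          rw [hcoe]
          exact mul_le_mul_right this _
        exact absurd h1 (not_lt.2 h3)
    obtain ⟨r, hr1, hr2⟩ := ENNReal.lt_iff_exists_nnreal_btwn.1 h2
    have hr3 : 1 / (s' : ℝ) - 1 < r := by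
      rw [← ENNReal.ofReal_coe_nnreal] at hr1
      exact (ENNReal.ofReal_lt_ofReal_iff'.1 hr1).1
    rw [hcoe]
    refine dimH_upper hp hφ hE (g := r) hspos ?_ (gamma_lower hp (by simpa using hr2))
    rw [sub_lt_iff_lt_add, div_lt_iff₀ hspos] at hr3
    linarith
  · refine le_of_forall_lt fun s hs => ?_
    obtain ⟨s', hss, hs'⟩ := ENNReal.lt_iff_exists_nnreal_btwn.1 hs
    refine lt_of_lt_of_le hss ?_
    have hspos : (0:ℝ) < s' := by
      have : (0 : ℝ≥0∞) < s' := lt_of_le_of_lt bot_le hss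
      exact_mod_cast this
    have hcoe : (s' : ℝ≥0∞) = ENNReal.ofReal (s' : ℝ) := by simp
    have h1 : (s' : ℝ≥0∞) * (1 + gammaExp φ) < 1 := by
      rwa [ENNReal.lt_div_iff_mul_lt (by simp) (Or.inr (lt_of_le_of_lt bot_le hss).ne')] at hs'
    have h2 : gammaExp φ < ENNReal.ofReal (1 / s' - 1) := by
      by_contra! hcon
      have : ENNReal.ofReal (1 / s') ≤ 1 + gammaExp φ := by
        calc ENNReal.ofReal (1 / s') = ENNReal.ofReal (1 + (1 / s' - 1)) := by congr 1; ring
          _ ≤ ENNReal.ofReal 1 + ENNReal.ofReal (1 / s' - 1) := ENNReal.ofReal_add_le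
          _ ≤ 1 + gammaExp φ := by rw [ENNReal.ofReal_one]; gcongr
      have h3 : 1 ≤ (s' : ℝ≥0∞) * (1 + gammaExp φ) := by
        refine (hmul s' hspos).ge.trans ?_
        rw [hcoe]
        exact mul_le_mul_right this _
      exact absurd h1 (not_lt.2 h3)
    obtain ⟨r, hr1, hr2⟩ := ENNReal.lt_iff_exists_nnreal_btwn.1 h2
    have hr3 : (r : ℝ) < 1 / (s' : ℝ) - 1 := by
      rw [← ENNReal.ofReal_coe_nnreal] at hr2
      exact (ENNReal.ofReal_lt_ofReal_iff'.1 hr2).1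
    rw [hcoe]
    refine (dimH_gm hp hφ (g := r) hspos r.2 ?_ (gamma_upper hp (by simpa using hr1))).trans
      (dimH_mono hsub)
    rw [lt_sub_iff_add_lt, lt_div_iff₀ hspos] at hr3
    linarith

lemma upper_wit {φ : ℕ → ℝ} {c : ℕ → ℕ} (hc : StrictMono c) (h0 : 2 ≤ c 0)
    (h : Tendsto (fun n : ℕ =>
      Real.log (((c (n + 1) : ℝ) - 1) / ((c n : ℝ) - 1)) / φ (n + 1)) atTop (nhds 1)) :
    ∃ e : ℕ → ℕ, GoodD (fun i => (e i : ℝ)) ∧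
      Tendsto (fun n : ℕ => Real.log ((e (n + 1) : ℝ) / (e n : ℝ)) / φ (n + 1)) atTop (nhds 1) ∧
      pierce c = Qs (fun i => (e i : ℝ)) := by
  have hcast : ∀ i, ((c i - 1 : ℕ) : ℝ) = (c i : ℝ) - 1 := by
    intro i
    have : c 0 ≤ c i := hc.monotone (Nat.zero_le i)
    rw [Nat.cast_sub (by omega), Nat.cast_one]
  refine ⟨fun i => c i - 1, ?_, ?_, ?_⟩
  · simp only [hcast]; exact goodD_of hc h0
  · simp only [hcast]; exact h
  · simp only [hcast]; exact pierce_eq_Qs c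

lemma gm_wit {φ : ℕ → ℝ} (hp : ∀ n, 0 < φ n) (hφ : Tendsto φ atTop atTop) {x : ℝ}
    (hx : x ∈ gm φ '' Set.Ico 0 1) : ∃ c : ℕ → ℕ, StrictMono c ∧ 2 ≤ c 0 ∧
      Tendsto (fun n : ℕ =>
        Real.log (((c (n + 1) : ℝ) - 1) / ((c n : ℝ) - 1)) / φ (n + 1)) atTop (nhds 1) ∧
      x = pierce c := by
  obtain ⟨t, ht, rfl⟩ := hx
  refine ⟨fun i => dn φ t i + 1, (d_mono hp ht.1).add_const 1, ?_, ?_, ?_⟩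
  · have := d_ge φ t 0
    have := Bn_pos φ 0
    show 2 ≤ dn φ t 0 + 1
    omega
  · simpa using dn_tendsto hp hφ ht.1
  · rw [pierce_eq_Qs]; simp [gm]

/-- If `φ(n) → ∞`, then the sets of numbers whose Pierce digits (in Perron
notation `c_n`, resp. in traditional notation `c_n − 1`) satisfy
`lim log(c_n/c_{n−1})/φ(n) = 1`, resp. `lim log((c_n−1)/(c_{n−1}−1))/φ(n) = 1`, both have
Hausdorff dimension `1/(1+γ)`. -/
theorem dimH_pierce_log_ratio (φ : ℕ → ℝ) (hφpos : ∀ n, 0 < φ n)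
    (hφ : Tendsto φ atTop atTop) :
    dimH {x : ℝ | ∃ c : ℕ → ℕ, StrictMono c ∧ 2 ≤ c 0 ∧
        Tendsto (fun n : ℕ => Real.log ((c (n + 1) : ℝ) / (c n : ℝ)) / φ (n + 1)) atTop
          (nhds 1) ∧
        x = pierce c} = 1 / (1 + gammaExp φ) ∧
    dimH {x : ℝ | ∃ c : ℕ → ℕ, StrictMono c ∧ 2 ≤ c 0 ∧
        Tendsto (fun n : ℕ =>
            Real.log (((c (n + 1) : ℝ) - 1) / ((c n : ℝ) - 1)) / φ (n + 1)) atTop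
          (nhds 1) ∧
        x = pierce c} = 1 / (1 + gammaExp φ) := by
  constructor
  · refine dimH_main hφpos hφ ?_ ?_
    · rintro x ⟨c, hc, h0, h, rfl⟩
      exact upper_wit hc h0 (tendsto_of_bdd hφpos hφ (log_c_bdd (goodD_of hc h0)) h)
    · intro x hx
      obtain ⟨c, hc, h0, h, hxc⟩ := gm_wit hφpos hφ hx
      refine ⟨c, hc, h0, tendsto_of_bdd hφpos hφ (C := Real.log 2) (fun n => ?_) h, hxc⟩
      rw [abs_sub_comm]
      exact log_c_bdd (goodD_of hc h0) n
  · refine dimH_main hφpos hφ ?_ ?_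
    · rintro x ⟨c, hc, h0, h, rfl⟩
      exact upper_wit hc h0 h
    · intro x hx
      exact gm_wit hφpos hφ hx
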